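/- arXiv:1310.1685 — 2 statements merged into one kernel-verified Lean document; each statement's English description precedes it below -/
import Mathlib

section
/- Let E be a vector space over a field K, k, N ≥ 1, λ_{i,j} ∈ K, and ξ : {1,...,N+k-1} → E. Define v_j = (λ_{1,j}ξ(j), ..., λ_{k,j}ξ(j+k-1)) ∈ E^k. Let δ ≥ 0 and p, q ≥ 0 be such that rk_K(v_1,...,v_N) > (k + 4δ)(p + q - 1). Then for any m_1,...,m_q ∈ {1,...,N+k-1} there exist n_1,...,n_p ∈ {1,...,N+k-1} such that ξ(n_1),...,ξ(n_p) are K-linearly independent, |n_i - n_j| > δ for all i ≠ j, and |n_i - m_j| > δ for all i, j. -/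
/-- Two natural numbers lie at distance greater than `d`. -/
abbrev Far (d a b : ℕ) : Prop := a + d < b ∨ b + d < a

/-- The elements of `I` are pairwise at distance greater than `d`. -/
def Separated (d : ℕ) (I : Finset ℕ) : Prop :=
  ∀ a ∈ I, ∀ b ∈ I, a ≠ b → Far d a b

theorem exists_separated_cover (D : ℕ) (U : Finset ℕ) :
    ∃ S ⊆ U, Separated D S ∧ ∀ u ∈ U, ∃ s ∈ S, s ≤ u ∧ u ≤ s + D := by
  induction U using Finset.strongInduction with
  | H U ih =>
    rcases U.eq_empty_or_nonempty with rfl | hU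
    · exact ⟨∅, subset_rfl, by simp [Separated], by simp⟩
    · set c := U.min' hU
      have hc : c ∈ U := U.min'_mem hU
      have hmin : ∀ u ∈ U, c ≤ u := fun u hu => U.min'_le u hu
      obtain ⟨S, hSU, hS, hcov⟩ := ih (U.filter (fun u => c + D < u))
        (Finset.filter_ssubset.2 ⟨c, hc, by omega⟩)
      have hgt : ∀ s ∈ S, c + D < s := fun s hs => (Finset.mem_filter.1 (hSU hs)).2
      refine ⟨insert c S, ?_, ?_, ?_⟩
      · exact Finset.insert_subset hc (hSU.trans (Finset.filter_subset _ _))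
      · intro a ha b hb hab
        rw [Finset.mem_insert] at ha hb
        rcases ha with rfl | ha <;> rcases hb with rfl | hb
        · exact absurd rfl hab
        · exact Or.inl (hgt b hb)
        · exact Or.inr (hgt a ha)
        · exact hS a ha b hb hab
      · intro u hu
        by_cases h : c + D < u
        · obtain ⟨s, hs, h'⟩ := hcov u (Finset.mem_filter.2 ⟨hu, h⟩)
          exact ⟨s, Finset.mem_insert_of_mem hs, h'⟩
        · exact ⟨c, Finset.mem_insert_self _ _, hmin u hu, by omega⟩

section Exchange

variable {K E : Type*} [Field K] [AddCommGroup E] [Module K E]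

/-- If `w` lies in the span of the family over `A` but not over `A \ C`, then it can replace
some element of `C` without changing the span. -/
theorem exists_span_exchange (ξ : ℕ → E) (A C : Finset ℕ) (w : E)
    (hA : w ∈ Submodule.span K (ξ '' (A : Set ℕ)))
    (hC : w ∉ Submodule.span K (ξ '' ((A \ C : Finset ℕ) : Set ℕ))) :
    ∃ b ∈ A, b ∈ C ∧ Submodule.span K (insert w (ξ '' ((A.erase b : Finset ℕ) : Set ℕ))) =
      Submodule.span K (ξ '' (A : Set ℕ)) := by
  induction C using Finset.induction_on with
  | empty => simp at hC; exact absurd hA hC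
  | insert c C hc ih =>
    by_cases h : w ∈ Submodule.span K (ξ '' ((A \ C : Finset ℕ) : Set ℕ))
    · have hcA : c ∈ A := by
        by_contra hcA
        apply hC
        rwa [Finset.sdiff_insert, Finset.erase_eq_of_notMem (by simp [hcA])]
      refine ⟨c, hcA, Finset.mem_insert_self _ _, ?_⟩
      have hins : insert c (A \ insert c C) = A \ C := by
        rw [Finset.sdiff_insert, Finset.insert_erase (by simp [hcA, hc])]
      rw [← hins, Finset.coe_insert, Set.image_insert_eq] at h
      have h1 := mem_span_insert_exchange h hC
      have hsub : A \ insert c C ⊆ A.erase c := by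
        intro a; simp only [Finset.mem_sdiff, Finset.mem_insert, Finset.mem_erase]; tauto
      have h2 : ξ c ∈ Submodule.span K (insert w (ξ '' ((A.erase c : Finset ℕ) : Set ℕ))) :=
        Submodule.span_mono (Set.insert_subset_insert (Set.image_mono
          (Finset.coe_subset.2 hsub))) h1
      apply le_antisymm
      · rw [Submodule.span_le]
        apply Set.insert_subset hA
        exact (Set.image_mono (Finset.coe_subset.2 (A.erase_subset c))).trans
          Submodule.subset_span
      · rw [Submodule.span_le]
        rintro _ ⟨a, ha, rfl⟩
        by_cases hac : a = c
        · subst hac; exact h2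
        · exact Submodule.subset_span (Or.inr ⟨a, by
            simpa [hac] using ha, rfl⟩)
    · obtain ⟨b, hb, hbC, h⟩ := ih h
      exact ⟨b, hb, Finset.mem_insert_of_mem hbC, h⟩

/-- The augmentation step of the local search: a separated set `I` can be modified outside of `B`,
keeping the span of `I \ B`, so that some point outside that span is far from all of `I`. -/
theorem exists_augmenting_point (ξ : ℕ → E) (G : Set ℕ) (d p : ℕ)
    (H : ∀ T : Finset ℕ, ∃ S : Finset ℕ,
      (∀ x ∈ S, x ∈ G ∧ ξ x ∉ Submodule.span K (ξ '' (T : Set ℕ))) ∧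
      Separated (4 * d) S ∧ p ≤ T.card + S.card)
    (r : ℕ) (I B : Finset ℕ) (hr : (I \ B).card = r) (hB : B ⊆ I) (hI : I.card < p)
    (hG : ∀ x ∈ I, x ∈ G) (hsep : Separated d I) :
    ∃ (I' : Finset ℕ) (y : ℕ), B ⊆ I' ∧ I'.card = I.card ∧
      Submodule.span K (ξ '' ((I' \ B : Finset ℕ) : Set ℕ)) =
        Submodule.span K (ξ '' ((I \ B : Finset ℕ) : Set ℕ)) ∧
      (∀ x ∈ I', x ∈ G) ∧ Separated d I' ∧
      (∀ x ∈ I', x ∉ I → ∀ b ∈ B, Far (2 * d) x b) ∧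
      y ∈ G ∧ ξ y ∉ Submodule.span K (ξ '' ((I \ B : Finset ℕ) : Set ℕ)) ∧
      (∀ x ∈ I', Far d y x) ∧ (∀ b ∈ B, Far (2 * d) y b) := by
  induction r using Nat.strong_induction_on generalizing I B with
  | _ r ihr =>
    obtain ⟨x, hxG, hxI, hxB⟩ : ∃ x, x ∈ G ∧
        ξ x ∉ Submodule.span K (ξ '' ((I \ B : Finset ℕ) : Set ℕ)) ∧
        ∀ b ∈ B, Far (2 * d) x b := by
      obtain ⟨S, hS, hSsep, hcard⟩ := H (I \ B)
      by_contra hcon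
      have hnear : ∀ s ∈ S, ∃ b ∈ B, ¬ Far (2 * d) s b := by
        intro s hs
        by_contra h
        exact hcon ⟨s, (hS s hs).1, (hS s hs).2, fun b hb => by_contra fun hb' => h ⟨b, hb, hb'⟩⟩
      choose! f hfB hf using hnear
      have hBS : B.card < S.card := by
        have := Finset.card_sdiff_add_card_eq_card hB
        omega
      obtain ⟨s, hs, t, ht, hst, hfst⟩ :=
        Finset.exists_ne_map_eq_of_card_lt_of_maps_to hBS hfB
      have h1 := hf s hs
      have h2 := hf t ht
      have h3 := hSsep s hs t ht hst
      rw [← hfst] at h2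
      simp only [Far] at h1 h2 h3
      omega
    induction hc : (I.filter (fun a => ¬ Far d x a)).card using Nat.strong_induction_on
      generalizing I with
    | _ c ihc =>
      set C := I.filter (fun a => ¬ Far d x a) with hCdef
      rcases C.eq_empty_or_nonempty with hC | ⟨c₀, hc₀⟩
      · refine ⟨I, x, hB, rfl, rfl, hG, hsep, fun a h h' => absurd h h', hxG, hxI, ?_, hxB⟩
        intro a ha
        by_contra hfar
        have : a ∈ C := Finset.mem_filter.2 ⟨ha, hfar⟩
        simp [hC] at this
      · have hCI : C ⊆ I := Finset.filter_subset _ _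
        have hCnear : ∀ a ∈ C, ¬ Far d x a := fun a ha => (Finset.mem_filter.1 ha).2
        have hCB : ∀ a ∈ C, a ∉ B := by
          intro a ha haB
          have h1 := hCnear a ha
          have h2 := hxB a haB
          simp only [Far] at h1 h2
          omega
        have hlt : (I \ (B ∪ C)).card < r := by
          rw [← hr]
          apply Finset.card_lt_card
          refine (Finset.ssubset_iff_of_subset (Finset.sdiff_subset_sdiff subset_rfl
            Finset.subset_union_left)).2 ⟨c₀, ?_, ?_⟩
          · simp [hCI hc₀, hCB c₀ hc₀]
          · simp [hc₀]
        obtain ⟨I', y, hBI', hcardI', hspan', hG', hsep', hnew', hyG, hyspan, hyfar, hyB⟩ :=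
          ihr _ hlt I (B ∪ C) rfl (Finset.union_subset hB hCI) hI hG hsep
        have hBI : B ⊆ I' := Finset.subset_union_left.trans hBI'
        have hCI' : C ⊆ I' := Finset.subset_union_right.trans hBI'
        have hsplit : ∀ J : Finset ℕ, C ⊆ J → J \ B = (J \ (B ∪ C)) ∪ C := by
          intro J hJ
          ext a
          have h1 := hCB a
          have h2 := @hJ a
          simp only [Finset.mem_sdiff, Finset.mem_union]
          tauto
        have hspanB : Submodule.span K (ξ '' ((I' \ B : Finset ℕ) : Set ℕ)) =
            Submodule.span K (ξ '' ((I \ B : Finset ℕ) : Set ℕ)) := by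
          rw [hsplit I' hCI', hsplit I hCI, Finset.coe_union, Finset.coe_union,
            Set.image_union, Set.image_union, Submodule.span_union, Submodule.span_union, hspan']
        have hfarx : ∀ z, (∀ b ∈ B ∪ C, Far (2 * d) z b) → Far d x z := by
          intro z hz
          have h1 := hz c₀ (Finset.mem_union_right _ hc₀)
          have h2 := hCnear c₀ hc₀
          simp only [Far] at h1 h2 ⊢
          omega
        by_cases hy : ξ y ∈ Submodule.span K (ξ '' ((I' \ B : Finset ℕ) : Set ℕ))
        · have hdiff : (I' \ B) \ C = I' \ (B ∪ C) := by
            ext a; simp only [Finset.mem_sdiff, Finset.mem_union]; tauto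
          obtain ⟨b, hbI', hbC, hexch⟩ := exists_span_exchange ξ (I' \ B) C (ξ y) hy
            (by rw [hdiff, hspan']; exact hyspan)
          rw [Finset.mem_sdiff] at hbI'
          have hyI' : y ∉ I' := by
            intro h
            have := hyfar y h
            simp only [Far] at this
            omega
          have hyB' : y ∉ B := fun h => hyI' (hBI h)
          set I₂ := insert y (I'.erase b) with hI₂
          have hI₂card : I₂.card = I.card := by
            rw [hI₂, Finset.card_insert_of_notMem (fun h => hyI' (Finset.mem_of_mem_erase h)),
              Finset.card_erase_add_one hbI'.1, hcardI']
          have hI₂B : I₂ \ B = insert y ((I' \ B).erase b) := by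
            ext a
            by_cases hay : a = y
            · subst hay; simp [hI₂, hyB']
            · simp only [hI₂, Finset.mem_sdiff, Finset.mem_insert, Finset.mem_erase, hay]
              tauto
          have hspan₂ : Submodule.span K (ξ '' ((I₂ \ B : Finset ℕ) : Set ℕ)) =
              Submodule.span K (ξ '' ((I \ B : Finset ℕ) : Set ℕ)) := by
            rw [hI₂B, Finset.coe_insert, Set.image_insert_eq, hexch, hspanB]
          have hBI₂ : B ⊆ I₂ := by
            intro a ha
            refine Finset.mem_insert_of_mem (Finset.mem_erase.2 ⟨?_, hBI ha⟩)
            rintro rfl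
            exact hbI'.2 ha
          have hmem₂ : ∀ a ∈ I₂, a = y ∨ (a ≠ b ∧ a ∈ I') := by
            intro a ha
            simpa [hI₂] using ha
          have hsep₂ : Separated d I₂ := by
            intro a ha a' ha' haa'
            rcases hmem₂ a ha with rfl | ⟨-, h⟩ <;> rcases hmem₂ a' ha' with rfl | ⟨-, h'⟩
            · exact absurd rfl haa'
            · exact hyfar a' h'
            · exact (hyfar a h).symm
            · exact hsep' a h a' h' haa'
          have hG₂ : ∀ a ∈ I₂, a ∈ G := by
            intro a ha
            rcases hmem₂ a ha with rfl | ⟨-, h⟩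
            · exact hyG
            · exact hG' a h
          have hblock : (I₂.filter (fun a => ¬ Far d x a)).card < c := by
            rw [← hc]
            apply Finset.card_lt_card
            refine (Finset.ssubset_iff_of_subset ?_).2 ⟨b, hbC, ?_⟩
            · intro a ha
              rw [Finset.mem_filter] at ha
              rcases hmem₂ a ha.1 with rfl | ⟨-, h⟩
              · exact absurd (hfarx a hyB) ha.2
              · by_cases haI : a ∈ I
                · exact Finset.mem_filter.2 ⟨haI, ha.2⟩
                · exact absurd (hfarx a (hnew' a h haI)) ha.2
            · intro h
              rcases hmem₂ b (Finset.mem_filter.1 h).1 with h | h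
              · exact hyI' (h ▸ hbI'.1)
              · exact h.1 rfl
          have hr₂ : (I₂ \ B).card = r := by
            have h1 := Finset.card_sdiff_add_card_eq_card hBI₂
            have h2 := Finset.card_sdiff_add_card_eq_card hB
            omega
          obtain ⟨I₃, z, h1, h2, h3, h4, h5, h6, h7, h8, h9, h10⟩ :=
            ihc _ hblock I₂ hr₂ hBI₂ (by omega) hG₂ hsep₂ (by rw [hspan₂]; exact hxI) rfl
          refine ⟨I₃, z, h1, by omega, h3.trans hspan₂, h4, h5, ?_, h7, hspan₂ ▸ h8, h9, h10⟩
          intro a ha haI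
          by_cases ha₂ : a ∈ I₂
          · rcases hmem₂ a ha₂ with rfl | ⟨-, h⟩
            · exact fun b' hb' => hyB b' (Finset.mem_union_left _ hb')
            · exact fun b' hb' => hnew' a h haI b' (Finset.mem_union_left _ hb')
          · exact h6 a ha ha₂
        · refine ⟨I', y, hBI, hcardI', hspanB, hG', hsep', ?_, hyG, hspanB ▸ hy, hyfar, ?_⟩
          · exact fun a ha haI b hb => hnew' a ha haI b (Finset.mem_union_left _ hb)
          · exact fun b hb => hyB b (Finset.mem_union_left _ hb)

/-- A Rado-type theorem for linearly independent separated systems of representatives. -/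
theorem exists_separated_linearIndepOn (ξ : ℕ → E) (G : Set ℕ) (d p : ℕ)
    (H : ∀ T : Finset ℕ, ∃ S : Finset ℕ,
      (∀ x ∈ S, x ∈ G ∧ ξ x ∉ Submodule.span K (ξ '' (T : Set ℕ))) ∧
      Separated (4 * d) S ∧ p ≤ T.card + S.card) :
    ∃ I : Finset ℕ, I.card = p ∧ (∀ x ∈ I, x ∈ G) ∧ Separated d I ∧
      LinearIndepOn K ξ (I : Set ℕ) := by
  suffices ∀ s ≤ p, ∃ I : Finset ℕ, I.card = s ∧ (∀ x ∈ I, x ∈ G) ∧ Separated d I ∧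
      LinearIndepOn K ξ (I : Set ℕ) from this p le_rfl
  intro s
  induction s with
  | zero => exact fun _ => ⟨∅, rfl, by simp, by simp [Separated], by simp⟩
  | succ s ih =>
    intro hs
    obtain ⟨I, hcard, hG, hsep, hind⟩ := ih (by omega)
    obtain ⟨I', y, -, hcard', hspan, hG', hsep', -, hyG, hy, hyfar, -⟩ :=
      exists_augmenting_point (K := K) ξ G d p H _ I ∅ rfl (by simp) (by omega) hG hsep
    rw [Finset.sdiff_empty, Finset.sdiff_empty] at hspan
    rw [Finset.sdiff_empty, ← hspan] at hy
    have hyI' : y ∉ I' := by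
      intro h
      have := hyfar y h
      simp only [Far] at this
      omega
    have hind' : LinearIndepOn K ξ (I' : Set ℕ) := by
      have h1 := linearIndependent_iff_card_eq_finrank_span.1 hind
      refine linearIndependent_iff_card_eq_finrank_span.2 ?_
      have hr : ∀ J : Finset ℕ, Set.range (fun i : (J : Set ℕ) => ξ i) = ξ '' (J : Set ℕ) :=
        fun J => (Set.image_eq_range _ _).symm
      rw [hr] at h1 ⊢
      rw [Set.finrank] at h1 ⊢
      rw [hspan, ← h1]
      simpa using hcard'
    refine ⟨insert y I', ?_, ?_, ?_, ?_⟩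
    · rw [Finset.card_insert_of_notMem hyI', hcard', hcard]
    · intro a ha
      rcases Finset.mem_insert.1 ha with rfl | ha
      · exact hyG
      · exact hG' a ha
    · intro a ha b hb hab
      rcases Finset.mem_insert.1 ha with rfl | ha' <;> rcases Finset.mem_insert.1 hb with rfl | hb'
      · exact absurd rfl hab
      · exact hyfar b hb'
      · exact (hyfar a ha').symm
      · exact hsep' a ha' b hb' hab
    · rw [Finset.coe_insert]
      exact hind'.insert hy

/-- If `v j ∈ W ^ k` for all `j` outside `J`, then the rank of `v` is at most
`k * dim W + #J`. -/
theorem finrank_span_range_le_of_mem (k : ℕ) {ι : Type*} (v : ι → Fin k → E)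
    (W : Submodule K E) [FiniteDimensional K W] (J : Finset ι)
    (h : ∀ j ∉ J, ∀ i, v j i ∈ W) :
    Module.finrank K (Submodule.span K (Set.range v)) ≤ k * Module.finrank K W + J.card := by
  classical
  set L : (Fin k → W) →ₗ[K] (Fin k → E) := W.subtype.compLeft (Fin k)
  have hle : Submodule.span K (Set.range v) ≤
      LinearMap.range L ⊔ Submodule.span K ((J.image v : Finset (Fin k → E)) : Set _) := by
    rw [Submodule.span_le]
    rintro _ ⟨j, rfl⟩
    by_cases hj : j ∈ J
    · exact Submodule.mem_sup_right (Submodule.subset_span (by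
        simpa using ⟨j, hj, rfl⟩))
    · refine Submodule.mem_sup_left ⟨fun i => ⟨v j i, h j hj i⟩, ?_⟩
      ext i
      rfl
  calc _ ≤ _ := Submodule.finrank_mono hle
    _ ≤ _ := Submodule.finrank_add_le_finrank_add_finrank _ _
    _ ≤ _ := add_le_add ((LinearMap.finrank_range_le L).trans
        (by rw [Module.finrank_pi_fintype]; simp))
      ((finrank_span_finset_le_card _).trans Finset.card_image_le)

end Exchange

theorem card_fin_filter_le {N : ℕ} (a l : ℕ) :
    ((Finset.univ : Finset (Fin N)).filter
      (fun j : Fin N => a ≤ (j : ℕ) + l ∧ (j : ℕ) < a)).card ≤ l := by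
  rw [← Finset.card_map Fin.valEmbedding]
  refine (Finset.card_le_card (t := Finset.Ico (a - l) a) ?_).trans ?_
  · intro x hx
    simp only [Finset.mem_map, Finset.mem_filter, Finset.mem_univ, true_and,
      Fin.valEmbedding_apply] at hx
    obtain ⟨j, hj, rfl⟩ := hx
    rw [Finset.mem_Ico]
    omega
  · rw [Nat.card_Ico]
    omega

theorem stmt_10 (K : Type*) [Field K] (E : Type*) [AddCommGroup E] [Module K E]
    (k N p q : ℕ) (hk : 1 ≤ k) (hN : 1 ≤ N)
    (lam : Fin k → Fin N → K) (ξ : ℕ → E)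
    (v : Fin N → (Fin k → E))
    (hv : ∀ j i, v j i = lam i j • ξ ((j:ℕ) + 1 + (i:ℕ)))
    (δ : ℝ) (hδ : 0 ≤ δ)
    (hrank : ((k:ℝ) + 4*δ) * ((p:ℝ) + (q:ℝ) - 1) <
      (Module.finrank K (Submodule.span K (Set.range v)) : ℝ))
    (m : Fin q → ℕ) (hm : ∀ j, m j ∈ Finset.Icc 1 (N + k - 1)) :
    ∃ n : Fin p → ℕ, (∀ i, n i ∈ Finset.Icc 1 (N + k - 1)) ∧
      LinearIndependent K (fun i => ξ (n i)) ∧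
      (∀ i j, i ≠ j → δ < |((n i : ℝ)) - (n j : ℝ)|) ∧
      (∀ i j, δ < |((n i : ℝ)) - (m j : ℝ)|) := by
  classical
  set d := ⌊δ⌋₊ with hd
  have hdδ : (d : ℝ) ≤ δ := Nat.floor_le hδ
  have hfar : ∀ a b : ℕ, Far d a b → δ < |(a : ℝ) - b| := by
    intro a b h
    have h1 : δ < d + 1 := Nat.lt_floor_add_one δ
    rcases h with h | h
    · have h2 : (a : ℝ) + d + 1 ≤ b := by exact_mod_cast h
      rw [abs_sub_comm]
      exact lt_of_lt_of_le (by linarith) (le_abs_self _)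
    · have h2 : (b : ℝ) + d + 1 ≤ a := by exact_mod_cast h
      exact lt_of_lt_of_le (by linarith) (le_abs_self _)
  set G : Finset ℕ := (Finset.Icc 1 (N + k - 1)).filter (fun n => ∀ j, Far d n (m j)) with hG
  have H : ∀ T : Finset ℕ, ∃ S : Finset ℕ,
      (∀ x ∈ S, x ∈ (G : Set ℕ) ∧ ξ x ∉ Submodule.span K (ξ '' (T : Set ℕ))) ∧
      Separated (4 * d) S ∧ p ≤ T.card + S.card := by
    intro T
    obtain ⟨S, hSU, hSsep, hcov⟩ := exists_separated_cover (4 * d)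
      (G.filter (fun n => ξ n ∉ Submodule.span K (ξ '' (T : Set ℕ))))
    refine ⟨S, fun x hx => Finset.mem_filter.1 (hSU hx), hSsep, ?_⟩
    have : FiniteDimensional K (Submodule.span K (ξ '' (T : Set ℕ))) :=
      FiniteDimensional.span_of_finite K (T.finite_toSet.image ξ)
    have hW : Module.finrank K (Submodule.span K (ξ '' (T : Set ℕ))) ≤ T.card := by
      rw [← Finset.coe_image]
      exact (finrank_span_finset_le_card _).trans Finset.card_image_le
    set J : Finset (Fin N) :=
      (S.biUnion fun s => Finset.univ.filter
        (fun j : Fin N => s + 4 * d ≤ (j : ℕ) + (k + 4 * d) ∧ (j : ℕ) < s + 4 * d)) ∪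
      (Finset.univ.biUnion fun t : Fin q => Finset.univ.filter
        (fun j : Fin N => m t + d ≤ (j : ℕ) + (k + 2 * d) ∧ (j : ℕ) < m t + d)) with hJ
    have hJcard : J.card ≤ S.card * (k + 4 * d) + q * (k + 2 * d) := by
      refine (Finset.card_union_le _ _).trans (add_le_add ?_ ?_)
      · exact Finset.card_biUnion_le_card_mul _ _ _ fun s _ => card_fin_filter_le _ _
      · simpa using Finset.card_biUnion_le_card_mul (Finset.univ : Finset (Fin q)) _ _
          fun t _ => card_fin_filter_le (m t + d) (k + 2 * d)
    have hmemJ : ∀ j ∉ J, ∀ i, v j i ∈ Submodule.span K (ξ '' (T : Set ℕ)) := by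
      intro j hj i
      rw [hv]
      refine Submodule.smul_mem _ _ ?_
      by_contra hcon
      apply hj
      have hi := i.isLt
      have hjN := j.isLt
      rw [hJ, Finset.mem_union, Finset.mem_biUnion, Finset.mem_biUnion]
      by_cases hg : ∀ t, Far d ((j : ℕ) + 1 + i) (m t)
      · obtain ⟨s, hs, h1, h2⟩ := hcov ((j : ℕ) + 1 + i) (Finset.mem_filter.2
          ⟨Finset.mem_filter.2 ⟨Finset.mem_Icc.2 (by omega), hg⟩, hcon⟩)
        refine Or.inl ⟨s, hs, Finset.mem_filter.2 ⟨Finset.mem_univ _, ?_⟩⟩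
        omega
      · push Not at hg
        obtain ⟨t, ht⟩ := hg
        refine Or.inr ⟨t, Finset.mem_univ _, Finset.mem_filter.2 ⟨Finset.mem_univ _, ?_⟩⟩
        omega
    have hle := finrank_span_range_le_of_mem k v _ J hmemJ
    have hle' : Module.finrank K (Submodule.span K (Set.range v)) ≤
        (k + 4 * d) * (T.card + S.card + q) := by
      refine hle.trans ((add_le_add (Nat.mul_le_mul_left k hW) hJcard).trans ?_)
      have h1 : 0 ≤ d * T.card := Nat.zero_le _
      have h2 : 0 ≤ d * q := Nat.zero_le _
      nlinarith
    have hle'' : (Module.finrank K (Submodule.span K (Set.range v)) : ℝ) ≤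
        ((k : ℝ) + 4 * d) * (T.card + S.card + q) := by exact_mod_cast hle'
    have hlt : ((k : ℝ) + 4 * δ) * ((p : ℝ) + q - 1) <
        ((k : ℝ) + 4 * δ) * (T.card + S.card + q) :=
      hrank.trans_le (hle''.trans (by gcongr))
    have hlt' := lt_of_mul_lt_mul_left hlt (by positivity)
    have hlt'' : (p : ℝ) < T.card + S.card + 1 := by linarith
    have : p < T.card + S.card + 1 := by exact_mod_cast hlt''
    omega
  obtain ⟨I, hcard, hIG, hsep, hind⟩ := exists_separated_linearIndepOn (K := K) ξ G d p H
  set e := (I.equivFinOfCardEq hcard).symm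
  have hmem : ∀ i, (e i : ℕ) ∈ G := fun i => hIG _ (e i).2
  refine ⟨fun i => e i, fun i => (Finset.mem_filter.1 (hmem i)).1, ?_, ?_, ?_⟩
  · exact LinearIndependent.comp hind e e.injective
  · intro i j hij
    refine hfar _ _ (hsep _ (e i).2 _ (e j).2 fun h => hij (e.injective (Subtype.ext h)))
  · exact fun i j => hfar _ _ ((Finset.mem_filter.1 (hmem i)).2 j)
end

section
/- Let E be a K-vector space, k, N ≥ 1, λ_{i,j} ∈ K, ξ : {1,...,N+k-1} → E, and v_j = (λ_{1,j}ξ(j), ..., λ_{k,j}ξ(j+k-1)) ∈ E^k. Let δ ≥ 1 and p, q ≥ 0 satisfy rk_K(v_1,...,v_N) > (k+4δ)(p+q). Let R_1,...,R_q, S_1,...,S_q ∈ {1,...,N+k-1} with R_j ≤ S_j ≤ R_j + 4δ, and set N' = {1,...,N+k-1} \ ∪_j [R_j, S_j]. If n_1,...,n_p ∈ N' are such that ξ(n_1),...,ξ(n_p) are K-linearly independent with |n_i - n_j| > δ for i ≠ j, then there exist n'_1,...,n'_{p+1} ∈ N' with ξ(n'_1),...,ξ(n'_{p+1}) K-linearly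 independent, |n'_i - n'_j| > δ for i ≠ j, and span_K(ξ(n_1),...,ξ(n_p)) ⊆ span_K(ξ(n'_1),...,ξ(n'_{p+1})). -/
/-- The span of those `v j` whose window `{j + 1, …, j + k}` lies in `X`. -/
def windowSpan (K : Type*) [Field K] {E : Type*} [AddCommGroup E] [Module K E] {k N : ℕ}
    (v : Fin N → (Fin k → E)) (X : Set ℕ) : Submodule K (Fin k → E) :=
  Submodule.span K (v '' {j | ∀ i : Fin k, (j : ℕ) + 1 + (i : ℕ) ∈ X})

/-- `s` consists of `δ`-separated points of `X` with linearly independent values under `ξ`. -/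
structure IsSeparatedIndep (K : Type*) [Field K] {E : Type*} [AddCommGroup E] [Module K E]
    (ξ : ℕ → E) (δ : ℝ) (X : Set ℕ) (s : Finset ℕ) : Prop where
  subset : (s : Set ℕ) ⊆ X
  indep : LinearIndepOn K ξ (s : Set ℕ)
  sep : (s : Set ℕ).Pairwise fun x y => δ < |(x : ℝ) - (y : ℝ)|

section

variable {K : Type*} [Field K] {E : Type*} [AddCommGroup E] [Module K E]

lemma card_windows_meeting_le {k N : ℕ} {L : ℝ} (hL : 0 ≤ L) {a b : ℝ} (hab : b - a ≤ L) :
    (Nat.card {j : Fin N | ∃ i : Fin k, (((j : ℕ) + 1 + (i : ℕ) : ℕ) : ℝ) ∈ Set.Icc a b} : ℝ)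
      ≤ k + L := by
  have hle : Nat.card {j : Fin N | ∃ i : Fin k,
      (((j : ℕ) + 1 + (i : ℕ) : ℕ) : ℝ) ∈ Set.Icc a b} ≤
      Nat.card (Finset.Icc ⌈a - k⌉ (⌊b⌋ - 1)) := by
    refine Nat.card_le_card_of_injective (fun j => ⟨((j : Fin N) : ℕ), ?_⟩) ?_
    · obtain ⟨j, i, h1, h2⟩ := j
      have hi : ((i : ℕ) : ℝ) + 1 ≤ k := by exact_mod_cast i.2
      push_cast at h1 h2
      have hi0 : (0 : ℝ) ≤ ((i : ℕ) : ℝ) := Nat.cast_nonneg _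
      rw [Finset.mem_Icc]
      constructor
      · apply Int.ceil_le.2
        push_cast
        linarith
      · have : ((j : ℕ) : ℤ) + 1 ≤ ⌊b⌋ := by
          apply Int.le_floor.2
          push_cast
          linarith
        simp only
        omega
    · intro x y hxy
      simp only [Subtype.mk.injEq, Nat.cast_inj] at hxy
      exact Subtype.ext (Fin.ext hxy)
  refine (Nat.cast_le.2 hle).trans ?_
  rw [Nat.card_eq_fintype_card, Fintype.card_coe, Int.card_Icc]
  have hk : (0 : ℝ) ≤ k := Nat.cast_nonneg _
  have h1 := Int.le_ceil (a - k)
  have h2 := Int.floor_le b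
  rcases le_total 0 (⌊b⌋ - 1 + 1 - ⌈a - k⌉) with h | h
  · have : (((⌊b⌋ - 1 + 1 - ⌈a - k⌉).toNat : ℕ) : ℝ) =
        ((⌊b⌋ - 1 + 1 - ⌈a - k⌉ : ℤ) : ℝ) := by
      rw [← Int.cast_natCast, Int.toNat_of_nonneg h]
    rw [this]
    push_cast
    linarith
  · rw [Int.toNat_of_nonpos h]
    simp only [Nat.cast_zero]
    linarith

lemma finrank_windowSpan_diff_Icc {k N : ℕ} (v : Fin N → (Fin k → E)) (X : Set ℕ)
    {L : ℝ} (hL : 0 ≤ L) {a b : ℝ} (hab : b - a ≤ L) :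
    (Module.finrank K (windowSpan K v X) : ℝ) ≤
      Module.finrank K (windowSpan K v (X \ {x : ℕ | (x : ℝ) ∈ Set.Icc a b})) + (k + L) := by
  classical
  set J := {j : Fin N | ∃ i : Fin k, (((j : ℕ) + 1 + (i : ℕ) : ℕ) : ℝ) ∈ Set.Icc a b} with hJ
  have hsub : windowSpan K v X ≤ windowSpan K v (X \ {x : ℕ | (x : ℝ) ∈ Set.Icc a b}) ⊔
      Submodule.span K (v '' J) := by
    rw [windowSpan, windowSpan, ← Submodule.span_union, ← Set.image_union]
    refine Submodule.span_mono (Set.image_mono fun j hj => ?_)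
    by_cases h : j ∈ J
    · exact Or.inr h
    · exact Or.inl fun i => ⟨hj i, fun hi => h ⟨i, hi⟩⟩
  have : ∀ Y, Module.Finite K (windowSpan K v Y) := fun Y =>
    Module.Finite.span_of_finite K (Set.toFinite _)
  have : Module.Finite K (Submodule.span K (v '' J)) :=
    Module.Finite.span_of_finite K (Set.toFinite _)
  have h1 := (Submodule.finrank_mono hsub).trans (Submodule.finrank_add_le_finrank_add_finrank _ _)
  have h2 : Module.finrank K (Submodule.span K (v '' J)) ≤ Nat.card J := by
    refine (finrank_span_le_card (v '' J)).trans ?_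
    rw [← Set.ncard_eq_toFinset_card', Nat.card_coe_set_eq]
    exact Set.ncard_image_le
  have h3 : (Nat.card J : ℝ) ≤ k + L := card_windows_meeting_le hL hab
  have h4 : (Module.finrank K (windowSpan K v X) : ℝ) ≤
      Module.finrank K (windowSpan K v (X \ {x : ℕ | (x : ℝ) ∈ Set.Icc a b})) + Nat.card J := by
    exact_mod_cast h1.trans (Nat.add_le_add_left h2 _)
  linarith

lemma exists_notMem_of_mul_lt_finrank {k N : ℕ} {lam : Fin k → Fin N → K} {ξ : ℕ → E}
    {v : Fin N → (Fin k → E)} (hv : ∀ j i, v j i = lam i j • ξ ((j : ℕ) + 1 + (i : ℕ)))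
    {X : Set ℕ} (F : Submodule K E) [Module.Finite K F]
    (h : k * Module.finrank K F < Module.finrank K (windowSpan K v X)) :
    ∃ m ∈ X, ξ m ∉ F := by
  by_contra! hc
  have hle : windowSpan K v X ≤ LinearMap.range (F.subtype.compLeft (Fin k)) := by
    rw [windowSpan, Submodule.span_le]
    rintro _ ⟨j, hj, rfl⟩
    refine ⟨fun i => ⟨v j i, ?_⟩, rfl⟩
    rw [hv]
    exact F.smul_mem _ (hc _ (hj i))
  have h1 := (Submodule.finrank_mono hle).trans (LinearMap.finrank_range_le _)
  rw [Module.finrank_pi_fintype] at h1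
  simp only [Finset.sum_const, Finset.card_univ, Fintype.card_fin, smul_eq_mul] at h1
  omega

lemma IsSeparatedIndep.insert_of_notMem_span {ξ : ℕ → E} {δ : ℝ} {X : Set ℕ} {s : Finset ℕ}
    (hs : IsSeparatedIndep K ξ δ X s) {m : ℕ} (hm : m ∈ X)
    (hξ : ξ m ∉ Submodule.span K (ξ '' s)) (hfar : ∀ x ∈ s, δ < |(x : ℝ) - m|) :
    IsSeparatedIndep K ξ δ X (insert m s) where
  subset := by
    rw [Finset.coe_insert]
    exact Set.insert_subset hm hs.subset
  indep := by
    rw [Finset.coe_insert]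
    exact hs.indep.insert hξ
  sep := by
    rw [Finset.coe_insert]
    refine hs.sep.insert fun x hx _ => ⟨?_, hfar x hx⟩
    rw [abs_sub_comm]
    exact hfar x hx

lemma IsSeparatedIndep.exists_insert {ξ : ℕ → E} {δ : ℝ} {X : Set ℕ} {s : Finset ℕ}
    (hs : IsSeparatedIndep K ξ δ X s) {m : ℕ} (hm : m ∈ X)
    (hξ : ξ m ∉ Submodule.span K (ξ '' s)) (hfar : ∀ x ∈ s, δ < |(x : ℝ) - m|) :
    ∃ t : Finset ℕ, t.card = s.card + 1 ∧ IsSeparatedIndep K ξ δ X t ∧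
      Submodule.span K (ξ '' s) ≤ Submodule.span K (ξ '' t) := by
  refine ⟨_, Finset.card_insert_of_notMem fun h => ?_, hs.insert_of_notMem_span hm hξ hfar,
    Submodule.span_mono (Set.image_mono ?_)⟩
  · exact hξ (Submodule.subset_span ⟨m, h, rfl⟩)
  · exact Finset.coe_subset.2 (Finset.subset_insert _ _)

lemma IsSeparatedIndep.mono {ξ : ℕ → E} {δ : ℝ} {X Y : Set ℕ} {s t : Finset ℕ}
    (hs : IsSeparatedIndep K ξ δ X s) (hts : t ⊆ s) (hY : (t : Set ℕ) ⊆ Y) :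
    IsSeparatedIndep K ξ δ Y t where
  subset := hY
  indep := hs.indep.mono (Finset.coe_subset.2 hts)
  sep := hs.sep.mono (Finset.coe_subset.2 hts)

lemma IsSeparatedIndep.finrank_span {ξ : ℕ → E} {δ : ℝ} {X : Set ℕ} {s : Finset ℕ}
    (hs : IsSeparatedIndep K ξ δ X s) :
    Module.finrank K (Submodule.span K (ξ '' s)) = s.card := by
  have h := finrank_span_eq_card hs.indep
  rw [Set.image_eq_range, h]
  exact Fintype.card_coe s

/-- If the family obtained by dropping `b` can be enlarged outside of an interval containing the
`δ`-neighbourhood of `b`, then either `s` can be enlarged, or it can be moved out of the interval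
without changing its span. -/
lemma IsSeparatedIndep.enlarge_or_move {ξ : ℕ → E} {δ : ℝ} {X : Set ℕ} {s : Finset ℕ}
    (hs : IsSeparatedIndep K ξ δ X s) {a c : ℝ} {b : ℕ} (hb : b ∈ s)
    (hab : a ≤ b - δ) (hbc : b + δ ≤ c) (honly : ∀ x ∈ s, (x : ℝ) ∈ Set.Icc a c → x = b)
    (hstep : IsSeparatedIndep K ξ δ (X \ {x : ℕ | (x : ℝ) ∈ Set.Icc a c}) (s.erase b) →
      ∃ t : Finset ℕ, t.card = (s.erase b).card + 1 ∧
        IsSeparatedIndep K ξ δ (X \ {x : ℕ | (x : ℝ) ∈ Set.Icc a c}) t ∧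
        Submodule.span K (ξ '' (s.erase b : Finset ℕ)) ≤ Submodule.span K (ξ '' t)) :
    (∃ t : Finset ℕ, t.card = s.card + 1 ∧ IsSeparatedIndep K ξ δ X t ∧
      Submodule.span K (ξ '' s) ≤ Submodule.span K (ξ '' t)) ∨
    (∃ t : Finset ℕ, t.card = s.card ∧
      IsSeparatedIndep K ξ δ (X \ {x : ℕ | (x : ℝ) ∈ Set.Icc a c}) t ∧
      Submodule.span K (ξ '' s) = Submodule.span K (ξ '' t)) := by
  obtain ⟨t, htc, ht, hle⟩ := hstep (hs.mono (Finset.erase_subset _ _) fun x hx => by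
    have hx' := Finset.mem_erase.1 (Finset.mem_coe.1 hx)
    exact ⟨hs.subset hx'.2, fun h => hx'.1 (honly x hx'.2 h)⟩)
  rw [Finset.card_erase_add_one hb] at htc
  have hspan : ∀ F : Submodule K E, Submodule.span K (ξ '' (s.erase b : Finset ℕ)) ≤ F →
      ξ b ∈ F → Submodule.span K (ξ '' s) ≤ F := by
    intro F h1 h2
    rw [Submodule.span_le]
    rintro _ ⟨x, hx, rfl⟩
    by_cases hxb : x = b
    · exact hxb ▸ h2
    · exact h1 (Submodule.subset_span ⟨x, Finset.mem_coe.2 (Finset.mem_erase.2 ⟨hxb, hx⟩), rfl⟩)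
  have htX : IsSeparatedIndep K ξ δ X t := ht.mono subset_rfl (ht.subset.trans Set.sdiff_subset)
  by_cases hξ : ξ b ∈ Submodule.span K (ξ '' t)
  · refine Or.inr ⟨t, htc, ht, ?_⟩
    have : Module.Finite K (Submodule.span K (ξ '' t)) :=
      Module.Finite.span_of_finite K (Set.toFinite _)
    exact Submodule.eq_of_le_of_finrank_eq (hspan _ hle hξ)
      (by rw [hs.finrank_span, ht.finrank_span, htc])
  · refine Or.inl ⟨insert b t, ?_, htX.insert_of_notMem_span (hs.subset hb) hξ fun x hx => ?_, ?_⟩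
    · rw [Finset.card_insert_of_notMem, htc]
      exact fun h => hξ (Submodule.subset_span ⟨b, h, rfl⟩)
    · have h := (ht.subset hx).2
      by_contra! hcon
      rw [abs_le] at hcon
      exact h ⟨by linarith, by linarith⟩
    · refine hspan _ (hle.trans (Submodule.span_mono (Set.image_mono ?_)))
        (Submodule.subset_span ⟨b, by simp, rfl⟩)
      exact Finset.coe_subset.2 (Finset.subset_insert _ _)

theorem IsSeparatedIndep.exists_enlarge {k N : ℕ} {lam : Fin k → Fin N → K} {ξ : ℕ → E}
    {v : Fin N → (Fin k → E)} (hv : ∀ j i, v j i = lam i j • ξ ((j : ℕ) + 1 + (i : ℕ)))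
    {δ : ℝ} (hδ : 0 ≤ δ) {p : ℕ} {X : Set ℕ} {s : Finset ℕ}
    (hrank : ((k : ℝ) + 4 * δ) * p < Module.finrank K (windowSpan K v X))
    (hs : IsSeparatedIndep K ξ δ X s) (hcard : s.card = p) :
    ∃ t : Finset ℕ, t.card = s.card + 1 ∧ IsSeparatedIndep K ξ δ X t ∧
      Submodule.span K (ξ '' s) ≤ Submodule.span K (ξ '' t) := by
  induction p generalizing X s with
  | zero =>
    obtain rfl := Finset.card_eq_zero.1 hcard
    have : Module.Finite K (Submodule.span K (ξ '' (∅ : Finset ℕ))) :=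
      Module.Finite.span_of_finite K (Set.toFinite _)
    obtain ⟨m, hm, hξ⟩ := exists_notMem_of_mul_lt_finrank hv (X := X)
      (Submodule.span K (ξ '' (∅ : Finset ℕ))) (by
        rw [hs.finrank_span, Finset.card_empty, mul_zero]
        simpa using hrank)
    exact hs.exists_insert hm hξ (by simp)
  | succ p ih =>
    have : Module.Finite K (Submodule.span K (ξ '' s)) :=
      Module.Finite.span_of_finite K (Set.toFinite _)
    obtain ⟨m, hm, hξ⟩ := exists_notMem_of_mul_lt_finrank hv (X := X)
      (Submodule.span K (ξ '' s)) (by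
        rw [hs.finrank_span, hcard]
        have h0 : 0 ≤ 4 * δ * ((p + 1 : ℕ) : ℝ) := by positivity
        have : ((k * (p + 1) : ℕ) : ℝ) < Module.finrank K (windowSpan K v X) := by
          push_cast at hrank h0 ⊢
          linarith
        exact_mod_cast this)
    have hstep : ∀ {t : Finset ℕ} {a c : ℝ} {b : ℕ}, t.card = p + 1 → b ∈ t → c - a ≤ 4 * δ →
        IsSeparatedIndep K ξ δ (X \ {x : ℕ | (x : ℝ) ∈ Set.Icc a c}) (t.erase b) →
        ∃ u : Finset ℕ, u.card = (t.erase b).card + 1 ∧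
          IsSeparatedIndep K ξ δ (X \ {x : ℕ | (x : ℝ) ∈ Set.Icc a c}) u ∧
          Submodule.span K (ξ '' (t.erase b : Finset ℕ)) ≤ Submodule.span K (ξ '' u) := by
      intro t a c b htc hb hac h
      refine ih ?_ h (by rw [Finset.card_erase_of_mem hb, htc, Nat.add_sub_cancel])
      have := finrank_windowSpan_diff_Icc (K := K) v X (by positivity : 0 ≤ 4 * δ) hac
      push_cast at hrank
      linarith
    by_cases hfar : ∀ x ∈ s, δ < |(x : ℝ) - m|
    · exact hs.exists_insert hm hξ hfar
    push Not at hfar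
    obtain ⟨b, hb, hbm⟩ := hfar
    rcases hs.enlarge_or_move (a := b - δ) (c := b + δ) hb le_rfl le_rfl
      (fun x hx hxI => by
        by_contra hne
        have : δ < |(x : ℝ) - b| := hs.sep hx hb hne
        rw [← not_le, abs_le] at this
        exact this ⟨by linarith [hxI.1], by linarith [hxI.2]⟩)
      (hstep hcard hb (by linarith)) with h | ⟨t, htc, ht, hst⟩
    · exact h
    have htX : IsSeparatedIndep K ξ δ X t := ht.mono subset_rfl (ht.subset.trans Set.sdiff_subset)
    rw [hst] at hξ ⊢
    rw [← htc]
    by_cases hfar : ∀ x ∈ t, δ < |(x : ℝ) - m|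
    · exact htX.exists_insert hm hξ hfar
    push Not at hfar
    obtain ⟨c, hc, hcm⟩ := hfar
    have hmin := min_le_left (c : ℝ) m
    have hmin' := min_le_right (c : ℝ) m
    have hmax := le_max_left (c : ℝ) m
    have hmax' := le_max_right (c : ℝ) m
    rw [abs_le] at hbm hcm
    rcases htX.enlarge_or_move (a := min (c : ℝ) m - δ) (c := max (c : ℝ) m + δ) hc
      (by linarith) (by linarith)
      (fun x hx hxI => by
        by_contra hne
        have hxc : δ < |(x : ℝ) - c| := ht.sep hx hc hne
        have hxb := (ht.subset hx).2
        have hcb := (ht.subset hc).2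
        simp only [Set.mem_ofPred_eq, Set.mem_Icc, not_and_or, not_le] at hxb hcb
        obtain ⟨h1, h2⟩ := hxI
        rcases lt_abs.1 hxc with h | h <;> rcases le_total (c : ℝ) m with h' | h' <;>
          simp only [h', min_eq_left, min_eq_right, max_eq_left, max_eq_right] at h1 h2 <;>
          rcases hxb with hxb | hxb <;> rcases hcb with hcb | hcb <;> linarith)
      (hstep (htc.trans hcard) hc (by
        rcases le_total (c : ℝ) m with h' | h' <;>
          simp only [h', min_eq_left, min_eq_right, max_eq_left, max_eq_right] <;> linarith))
      with h | ⟨u, huc, hu, htu⟩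
    · exact h
    rw [htu] at hξ ⊢
    rw [← huc]
    refine (hu.mono subset_rfl (hu.subset.trans Set.sdiff_subset)).exists_insert hm hξ
      fun x hx => ?_
    have h := (hu.subset hx).2
    by_contra! hcon
    rw [abs_le] at hcon
    exact h ⟨by linarith, by linarith⟩

lemma finrank_windowSpan_diff_iUnion {k N : ℕ} (v : Fin N → (Fin k → E)) (X : Set ℕ)
    {L : ℝ} (hL : 0 ≤ L) {ι : Type*} (T : Finset ι) (a b : ι → ℝ)
    (hab : ∀ j, b j - a j ≤ L) :
    (Module.finrank K (windowSpan K v X) : ℝ) ≤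
      Module.finrank K (windowSpan K v (X \ {x : ℕ | ∃ j ∈ T, (x : ℝ) ∈ Set.Icc (a j) (b j)})) +
        (k + L) * T.card := by
  classical
  induction T using Finset.induction_on with
  | empty =>
    have heq : X \ {x : ℕ | ∃ j ∈ (∅ : Finset ι), (x : ℝ) ∈ Set.Icc (a j) (b j)} = X := by
      ext x
      simp
    rw [heq]
    simp
  | insert j T hj ih =>
    have h := finrank_windowSpan_diff_Icc (K := K) v
      (X \ {x : ℕ | ∃ j ∈ T, (x : ℝ) ∈ Set.Icc (a j) (b j)}) hL (hab j)
    have heq : (X \ {x : ℕ | ∃ j ∈ T, (x : ℝ) ∈ Set.Icc (a j) (b j)}) \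
        {x : ℕ | (x : ℝ) ∈ Set.Icc (a j) (b j)} =
        X \ {x : ℕ | ∃ i ∈ insert j T, (x : ℝ) ∈ Set.Icc (a i) (b i)} := by
      ext x
      simp only [Set.mem_sdiff, Set.mem_ofPred_eq, Finset.exists_mem_insert]
      rw [not_or, and_assoc, and_comm (a := ¬ _)]
    rw [heq] at h
    rw [Finset.card_insert_of_notMem hj]
    push_cast
    linarith

end

theorem stmt_11 (K : Type*) [Field K] (E : Type*) [AddCommGroup E] [Module K E]
    (k N p q : ℕ) (hk : 1 ≤ k) (hN : 1 ≤ N)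
    (lam : Fin k → Fin N → K) (ξ : ℕ → E)
    (v : Fin N → (Fin k → E))
    (hv : ∀ j i, v j i = lam i j • ξ ((j:ℕ) + 1 + (i:ℕ)))
    (δ : ℝ) (hδ : 1 ≤ δ)
    (hrank : ((k:ℝ) + 4*δ) * ((p:ℝ) + (q:ℝ)) <
      (Module.finrank K (Submodule.span K (Set.range v)) : ℝ))
    (R S : Fin q → ℕ)
    (hR : ∀ j, R j ∈ Finset.Icc 1 (N + k - 1)) (hS : ∀ j, S j ∈ Finset.Icc 1 (N + k - 1))
    (hRS : ∀ j, R j ≤ S j ∧ (S j : ℝ) ≤ (R j : ℝ) + 4*δ)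
    (n : Fin p → ℕ)
    (hn : ∀ i, n i ∈ Finset.Icc 1 (N + k - 1) ∧ ∀ j, n i ∉ Finset.Icc (R j) (S j))
    (hind : LinearIndependent K (fun i => ξ (n i)))
    (hsep : ∀ i j, i ≠ j → δ < |((n i : ℝ)) - (n j : ℝ)|) :
    ∃ n' : Fin (p+1) → ℕ,
      (∀ i, n' i ∈ Finset.Icc 1 (N + k - 1) ∧ ∀ j, n' i ∉ Finset.Icc (R j) (S j)) ∧
      LinearIndependent K (fun i => ξ (n' i)) ∧
      (∀ i j, i ≠ j → δ < |((n' i : ℝ)) - (n' j : ℝ)|) ∧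
      Submodule.span K (Set.range (fun i => ξ (n i))) ≤
        Submodule.span K (Set.range (fun i => ξ (n' i))) := by
  classical
  have hδ0 : 0 ≤ δ := zero_le_one.trans hδ
  set X₀ : Set ℕ := {x | x ∈ Finset.Icc 1 (N + k - 1)}
  set X : Set ℕ := X₀ \ {x : ℕ | ∃ j ∈ (Finset.univ : Finset (Fin q)),
    (x : ℝ) ∈ Set.Icc (R j : ℝ) (S j)} with hX
  have hmemX : ∀ x, x ∈ X ↔
      x ∈ Finset.Icc 1 (N + k - 1) ∧ ∀ j, x ∉ Finset.Icc (R j) (S j) := by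
    intro x
    simp [hX, X₀]
  have hX₀ : windowSpan K v X₀ = Submodule.span K (Set.range v) := by
    rw [windowSpan, ← Set.image_univ]
    congr 2
    refine Set.eq_univ_of_forall fun j i => ?_
    change _ ∈ Finset.Icc 1 (N + k - 1)
    rw [Finset.mem_Icc]
    have := j.2
    have := i.2
    omega
  have hrankX : ((k : ℝ) + 4 * δ) * p < Module.finrank K (windowSpan K v X) := by
    have h := finrank_windowSpan_diff_iUnion (K := K) v X₀ (by positivity : 0 ≤ 4 * δ)
      (Finset.univ : Finset (Fin q)) (fun j => (R j : ℝ)) (fun j => (S j : ℝ))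
      (fun j => by linarith [(hRS j).2])
    rw [hX₀, Finset.card_univ, Fintype.card_fin] at h
    rw [mul_add] at hrank
    linarith
  have hinj : Function.Injective n := fun i j hij => hind.injective (congrArg ξ hij)
  have hcoe : ((Finset.univ.image n : Finset ℕ) : Set ℕ) = Set.range n := by simp
  have himg : ξ '' ((Finset.univ.image n : Finset ℕ) : Set ℕ) = Set.range fun i => ξ (n i) := by
    rw [hcoe, ← Set.range_comp]
    rfl
  have hs : IsSeparatedIndep K ξ δ X (Finset.univ.image n) := by
    refine ⟨?_, ?_, ?_⟩
    · rw [hcoe]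
      rintro _ ⟨i, rfl⟩
      exact (hmemX _).2 (hn i)
    · rw [hcoe]
      exact (linearIndepOn_range_iff hinj ξ).2 hind
    · rw [hcoe]
      rintro _ ⟨i, rfl⟩ _ ⟨j, rfl⟩ hij
      exact hsep i j fun h => hij (h ▸ rfl)
  have hcard : (Finset.univ.image n).card = p := by
    rw [Finset.card_image_of_injective _ hinj, Finset.card_univ, Fintype.card_fin]
  obtain ⟨t, htc, ht, hle⟩ := hs.exists_enlarge hv hδ0 hrankX hcard
  rw [hcard] at htc
  have hrange := Finset.range_orderEmbOfFin t htc
  have hinj' := (t.orderEmbOfFin htc).injective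
  have hmem := Finset.orderEmbOfFin_mem t htc
  refine ⟨t.orderEmbOfFin htc, fun i => (hmemX _).1 (ht.subset (hmem i)), ?_, ?_, ?_⟩
  · refine (linearIndepOn_range_iff hinj' ξ).1 ?_
    rw [hrange]
    exact ht.indep
  · exact fun i j hij => ht.sep (hmem i) (hmem j) (hinj'.ne hij)
  · rw [himg, ← hrange, ← Set.range_comp] at hle
    exact hle
end
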